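/- arXiv:0709.4402 — 8 statements merged into one kernel-verified Lean document; each statement's English description precedes it below -/
import Mathlib

section
/- Let X be a compact Hausdorff topological space and let C(X,ℝ) denote the ℝ-algebra of continuous real-valued functions on X (with pointwise operations). Then every unital ℝ-algebra homomorphism φ : C(X,ℝ) → ℝ (no continuity assumed) is the evaluation homomorphism at some point of X, and this point is unique; consequently the map sending x ∈ X to the evaluation homomorphism ev_x(a) = a(x) is a bijection between X and the set of unital ℝ-algebra homomorphisms C(X,ℝ) → ℝ. -/
/-- **Gelfand–Kolmogorov theorem.** For a compact Hausdorff topological space `X`,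
the map sending a point `x : X` to the evaluation homomorphism
`ev_x : C(X, ℝ) →ₐ[ℝ] ℝ`, `a ↦ a x`, is a bijection between `X` and the set of
unital `ℝ`-algebra homomorphisms `C(X, ℝ) → ℝ` (no continuity assumed). -/
theorem gelfand_kolmogorov (X : Type*) [TopologicalSpace X] [CompactSpace X] [T2Space X] :
    Function.Bijective (fun x : X =>
      ({ toFun := fun a : C(X, ℝ) => a x
         map_one' := rfl
         map_mul' := fun _ _ => rfl
         map_zero' := rfl
         map_add' := fun _ _ => rfl
         commutes' := fun _ => rfl } : C(X, ℝ) →ₐ[ℝ] ℝ)) := by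
  have h := (WeakDual.CharacterSpace.equivAlgHom (𝕜 := ℝ) (A := C(X, ℝ))).bijective.comp
    (WeakDual.CharacterSpace.continuousMapEval_bijective (X := X) (𝕜 := ℝ))
  exact h
end

section
/- For every k ≥ 1, the Frobenius form Φ_k(f; a₁,…,a_k) is a symmetric function of its arguments: for every permutation σ of {1,…,k} and all a₁,…,a_k ∈ A, Φ_k(f; a_{σ(1)},…,a_{σ(k)}) = Φ_k(f; a₁,…,a_k). -/
noncomputable section

variable {A B : Type*}

/-- The Frobenius forms `Φ_k(f; a₁, …, a_k)`, defined inductively by `Φ₀ = 1`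
(so that `Φ₁(f; a) = f a`) and
`Φ_{k+1}(f; a₁, …, a_{k+1}) = f a₁ · Φ_k(f; a₂, …, a_{k+1})
  − Σ_{i=2}^{k+1} Φ_k(f; a₂, …, a₁·aᵢ, …, a_{k+1})`. -/
def Phi [CommRing A] [CommRing B] [Algebra ℝ A] [Algebra ℝ B]
    (f : A →ₗ[ℝ] B) : (n : ℕ) → (Fin n → A) → B
  | 0, _ => 1
  | n + 1, a =>
      f (a 0) * Phi f n (fun i => a i.succ) -
        ∑ i : Fin n, Phi f n (Function.update (fun j => a j.succ) i (a 0 * a i.succ))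

section Symmetry

variable [CommRing A] [CommRing B] [Algebra ℝ A] [Algebra ℝ B]

theorem Phi_cons (f : A →ₗ[ℝ] B) (n : ℕ) (x : A) (r : Fin n → A) :
    Phi f (n + 1) (Fin.cons x r) =
      f x * Phi f n r - ∑ i, Phi f n (Function.update r i (x * r i)) := by
  simp [Phi]

/-- The first two arguments of a Frobenius form may be exchanged. -/
theorem Phi_cons_cons_comm (f : A →ₗ[ℝ] B) (n : ℕ) (x y : A) (r : Fin n → A) :
    Phi f (n + 2) (Fin.cons x (Fin.cons y r)) = Phi f (n + 2) (Fin.cons y (Fin.cons x r)) := by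
  have double_sum : ∑ i, ∑ j, Phi f n (Function.update (Function.update r i (x * r i)) j
        (y * Function.update r i (x * r i) j)) =
      ∑ i, ∑ j, Phi f n (Function.update (Function.update r i (y * r i)) j
        (x * Function.update r i (y * r i) j)) := by
    rw [Finset.sum_comm]
    refine Finset.sum_congr rfl fun i _ => Finset.sum_congr rfl fun j _ => ?_
    rcases eq_or_ne i j with rfl | hij
    · simp [mul_left_comm]
    · simp [hij, hij.symm, Function.update_comm hij]
  simp only [Phi_cons, Fin.sum_univ_succ, Fin.cons_zero, Fin.cons_succ, Fin.update_cons_zero,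
    ← Fin.cons_update, Finset.sum_sub_distrib, ← Finset.mul_sum, mul_comm y x]
  rw [double_sum]
  ring

/-- Symmetry of `Φ_n` gives symmetry of `Φ_{n+1}` in all arguments but the first. -/
theorem Phi_cons_comp_perm (f : A →ₗ[ℝ] B) (n : ℕ)
    (symm : ∀ (τ : Equiv.Perm (Fin n)) (r : Fin n → A), Phi f n (r ∘ τ) = Phi f n r)
    (τ : Equiv.Perm (Fin n)) (x : A) (r : Fin n → A) :
    Phi f (n + 1) (Fin.cons x (r ∘ τ)) = Phi f (n + 1) (Fin.cons x r) := by
  rw [Phi_cons, Phi_cons, symm,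
    ← Equiv.sum_comp τ fun i => Phi f n (Function.update r i (x * r i))]
  congr 1
  refine Finset.sum_congr rfl fun i _ => ?_
  rw [← symm τ (Function.update r (τ i) _), Function.update_comp_eq_of_injective _ τ.injective]
  rfl

theorem Phi_comp_perm (f : A →ₗ[ℝ] B) (n : ℕ) (σ : Equiv.Perm (Fin n)) (a : Fin n → A) :
    Phi f n (a ∘ σ) = Phi f n a := by
  induction n with
  | zero => rfl
  | succ n ih =>
    have hσ : σ ∈ Submonoid.closure
        (Set.range fun i : Fin n => Equiv.swap i.castSucc i.succ) := by
      rw [Equiv.Perm.mclosure_swap_castSucc_succ]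
      trivial
    induction hσ using Submonoid.closure_induction generalizing a with
    | one => rfl
    | mul σ τ _ _ hσ hτ => rw [Equiv.Perm.coe_mul, ← Function.comp_assoc, hτ, hσ]
    | mem σ hσ =>
      obtain ⟨i, rfl⟩ := hσ
      cases n with
      | zero => exact i.elim0
      | succ n =>
        cases a using Fin.consCases with | _ x r
        cases i using Fin.cases with
        | zero =>
          cases r using Fin.consCases with | _ y r
          rw [Phi_cons_cons_comm f n x y r]
          congr 1
          funext j
          refine Fin.cases ?_ (fun j => Fin.cases ?_ (fun j => ?_) j) j
          · simp
          · simp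
          · have h₀ : j.succ.succ ≠ 0 := Fin.succ_ne_zero _
            have h₁ : j.succ.succ ≠ 1 := by simp [Fin.ext_iff]
            simp [Equiv.swap_apply_of_ne_of_ne h₀ h₁]
        | succ i =>
          rw [← Phi_cons_comp_perm f (n + 1) ih (Equiv.swap i.castSucc i.succ) x r]
          congr 1
          funext j
          refine Fin.cases ?_ (fun j => ?_) j
          · rw [Function.comp_apply, Equiv.swap_apply_of_ne_of_ne] <;>
              simp [Fin.ext_iff]
          · simp only [Function.comp_apply, ← Fin.succ_castSucc,
              ← (Fin.succ_injective _).map_swap, Fin.cons_succ]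

end Symmetry

/-- The Frobenius form `Φ_k` is a symmetric function of its arguments. -/
theorem Phi_symmetric [CommRing A] [CommRing B] [Algebra ℝ A] [Algebra ℝ B]
    (f : A →ₗ[ℝ] B) (k : ℕ) (hk : 1 ≤ k) (σ : Equiv.Perm (Fin k)) (a : Fin k → A) :
    Phi f k (fun i => a (σ i)) = Phi f k a := by
  exact Phi_comp_perm f k σ a

end
end

section
/- The characteristic series has the exponential property: for any two ℝ-linear maps f, g : A → B and every a ∈ A, R(f+g, a, z) = R(f, a, z) · R(g, a, z) as formal power series in B[[z]]; equivalently, ψ_k(f+g, a) = Σ_{i=0}^{k} ψ_i(f,a)·ψ_{k−i}(g,a) for all k ≥ 0. -/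
noncomputable section

variable {A B : Type*}

/-- The coefficients `ψ_k(f, a)` of the characteristic series, defined by `ψ₀ = 1` and,
for `k ≥ 1`, by the recursion `k·ψ_k(f,a) = Σ_{i=1}^{k} (−1)^{i−1} f(aⁱ)·ψ_{k−i}(f,a)`. -/
def psi [CommRing A] [CommRing B] [Algebra ℝ A] [Algebra ℝ B]
    (f : A →ₗ[ℝ] B) (a : A) : ℕ → B
  | 0 => 1
  | k + 1 =>
      (((k : ℝ) + 1)⁻¹) • ∑ j ∈ Finset.range (k + 1),
        ((-1 : B) ^ j * f (a ^ (j + 1)) * psi f a (k - j))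
  decreasing_by exact Nat.lt_succ_of_le (Nat.sub_le k j)

section

open PowerSeries

/-- The logarithmic derivative `Σ_j (−1)^j f(a^(j+1)) z^j` of the characteristic series. -/
def charSeriesLogDeriv [CommRing A] [CommRing B] [Algebra ℝ A] [Algebra ℝ B]
    (f : A →ₗ[ℝ] B) (a : A) : PowerSeries B :=
  PowerSeries.mk fun j => (-1 : B) ^ j * f (a ^ (j + 1))

theorem charSeriesLogDeriv_add [CommRing A] [CommRing B] [Algebra ℝ A] [Algebra ℝ B]
    (f g : A →ₗ[ℝ] B) (a : A) :
    charSeriesLogDeriv (f + g) a = charSeriesLogDeriv f a + charSeriesLogDeriv g a := by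
  ext n
  simp [charSeriesLogDeriv, mul_add]

theorem coeff_charSeriesLogDeriv_mul [CommRing A] [CommRing B] [Algebra ℝ A] [Algebra ℝ B]
    (f : A →ₗ[ℝ] B) (a : A) (P : PowerSeries B) (n : ℕ) :
    coeff n (charSeriesLogDeriv f a * P) =
      ∑ j ∈ Finset.range (n + 1), (-1 : B) ^ j * f (a ^ (j + 1)) * coeff (n - j) P := by
  rw [coeff_mul, Finset.Nat.sum_antidiagonal_eq_sum_range_succ_mk]
  simp [charSeriesLogDeriv]

theorem derivative_mk_psi [CommRing A] [CommRing B] [Algebra ℝ A] [Algebra ℝ B]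
    (f : A →ₗ[ℝ] B) (a : A) :
    derivative B (PowerSeries.mk (psi f a)) =
      charSeriesLogDeriv f a * PowerSeries.mk (psi f a) := by
  ext n
  have hn : (n : ℝ) + 1 ≠ 0 := by positivity
  have hcast : ((n : B) + 1) = algebraMap ℝ B ((n : ℝ) + 1) := by simp
  rw [coeff_derivative, coeff_charSeriesLogDeriv_mul, coeff_mk, psi, hcast, mul_comm,
    ← Algebra.smul_def, smul_inv_smul₀ hn]
  simp only [coeff_mk]

theorem eq_mk_psi_of_derivative_eq [CommRing A] [CommRing B] [Algebra ℝ A] [Algebra ℝ B]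
    (f : A →ₗ[ℝ] B) (a : A) {P : PowerSeries B} (h0 : coeff 0 P = 1)
    (hP : derivative B P = charSeriesLogDeriv f a * P) :
    P = PowerSeries.mk (psi f a) := by
  ext n
  rw [coeff_mk]
  induction n using Nat.strong_induction_on with
  | _ n ih =>
    cases n with
    | zero => rw [h0, psi]
    | succ n =>
      have hn : (n : ℝ) + 1 ≠ 0 := by positivity
      have hcast : ((n : B) + 1) = algebraMap ℝ B ((n : ℝ) + 1) := by simp
      have h := congrArg (coeff n) hP
      rw [coeff_derivative, coeff_charSeriesLogDeriv_mul, hcast, mul_comm,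
        ← Algebra.smul_def] at h
      rw [psi, eq_inv_smul_iff₀ hn, h]
      exact Finset.sum_congr rfl fun j _ => by rw [ih (n - j) (by omega)]

end

/-- Exponential property of the characteristic series:
`R(f+g, a, z) = R(f, a, z) · R(g, a, z)` in `B[[z]]`; equivalently,
`ψ_k(f+g, a) = Σ_{i=0}^{k} ψ_i(f,a) · ψ_{k−i}(g,a)`. -/
theorem charSeries_add [CommRing A] [CommRing B] [Algebra ℝ A] [Algebra ℝ B]
    (f g : A →ₗ[ℝ] B) (a : A) :
    PowerSeries.mk (psi (f + g) a) = PowerSeries.mk (psi f a) * PowerSeries.mk (psi g a) ∧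
      ∀ k : ℕ, psi (f + g) a k = ∑ i ∈ Finset.range (k + 1), psi f a i * psi g a (k - i) := by
  have h : PowerSeries.mk (psi (f + g) a) =
      PowerSeries.mk (psi f a) * PowerSeries.mk (psi g a) := by
    symm
    apply eq_mk_psi_of_derivative_eq
    · simp [PowerSeries.coeff_mul, psi]
    · rw [Derivation.leibniz, derivative_mk_psi, derivative_mk_psi, charSeriesLogDeriv_add,
        smul_eq_mul, smul_eq_mul]
      ring
  refine ⟨h, fun k => ?_⟩
  have hk := congrArg (PowerSeries.coeff k) h
  rw [PowerSeries.coeff_mul, Finset.Nat.sum_antidiagonal_eq_sum_range_succ_mk] at hk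
  simpa only [PowerSeries.coeff_mk] using hk

end
end

section
/- If f : A → B is an n-homomorphism and g : A → B is an m-homomorphism (n, m ∈ ℕ), then f + g : A → B is an (n+m)-homomorphism. -/
noncomputable section

variable {A B : Type*}

/-- `f : A → B` is an `n`-homomorphism in the sense of Buchstaber–Rees if
`f 1 = n · 1` and `Φ_{n+1}(f; a₁, …, a_{n+1}) = 0` for all arguments. -/
def IsNHom [CommRing A] [CommRing B] [Algebra ℝ A] [Algebra ℝ B]
    (n : ℕ) (f : A →ₗ[ℝ] B) : Prop :=
  f 1 = (n : B) ∧ ∀ a : Fin (n + 1) → A, Phi f (n + 1) a = 0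

/-- The sum of `G` over the lists obtained from `l` by multiplying one entry by `a`. -/
def mulEntrySum [Mul A] [AddCommMonoid B] (a : A) (G : List A → B) (l : List A) : B :=
  ∑ i : Fin l.length, G (l.set i (a * l.get i))

/-- The sum of `F p q` over all ways of splitting a list into two complementary sublists `p`
and `q`. -/
def splitSum [AddCommMonoid B] : (List A → List A → B) → List A → B
  | F, [] => F [] []
  | F, a :: l => splitSum (fun p q => F (a :: p) q + F p (a :: q)) l

section Sums

variable [CommRing B]

theorem mulEntrySum_nil [Mul A] (a : A) (G : List A → B) : mulEntrySum a G [] = 0 := by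
  simp [mulEntrySum]

theorem mulEntrySum_cons [Mul A] (a b : A) (G : List A → B) (l : List A) :
    mulEntrySum a G (b :: l) = G (a * b :: l) + mulEntrySum a (fun l' => G (b :: l')) l := by
  simp only [mulEntrySum, List.length_cons]
  rw [Fin.sum_univ_succ]
  simp

theorem mulEntrySum_congr [Mul A] (a : A) {G G' : List A → B} {l : List A}
    (h : ∀ l' : List A, l'.length = l.length → G l' = G' l') :
    mulEntrySum a G l = mulEntrySum a G' l :=
  Finset.sum_congr rfl fun _ _ => h _ (by simp)

theorem mulEntrySum_add [Mul A] (a : A) (G G' : List A → B) (l : List A) :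
    mulEntrySum a (fun l' => G l' + G' l') l = mulEntrySum a G l + mulEntrySum a G' l :=
  Finset.sum_add_distrib

theorem mulEntrySum_const_mul [Mul A] (a : A) (c : B) (G : List A → B) (l : List A) :
    mulEntrySum a (fun l' => c * G l') l = c * mulEntrySum a G l :=
  (Finset.mul_sum _ _ _).symm

theorem mulEntrySum_mul_const [Mul A] (a : A) (c : B) (G : List A → B) (l : List A) :
    mulEntrySum a (fun l' => G l' * c) l = mulEntrySum a G l * c :=
  (Finset.sum_mul _ _ _).symm

theorem splitSum_add (F G : List A → List A → B) (l : List A) :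
    splitSum (fun p q => F p q + G p q) l = splitSum F l + splitSum G l := by
  induction l generalizing F G with
  | nil => rfl
  | cons a l ih =>
    simp only [splitSum, ih]
    ring

theorem splitSum_const_mul (c : B) (F : List A → List A → B) (l : List A) :
    splitSum (fun p q => c * F p q) l = c * splitSum F l := by
  induction l generalizing F with
  | nil => rfl
  | cons a l ih => simp only [splitSum, ← mul_add, ih]

theorem splitSum_eq_zero {F : List A → List A → B} {l : List A}
    (h : ∀ p q : List A, p.length + q.length = l.length → F p q = 0) : splitSum F l = 0 := by
  induction l generalizing F with
  | nil => exact h [] [] rfl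
  | cons a l ih =>
    refine ih fun p q hpq => ?_
    rw [h _ _ (by simp only [List.length_cons]; omega),
      h _ _ (by simp only [List.length_cons]; omega), add_zero]

theorem mulEntrySum_splitSum [Mul A] (a : A) (F : List A → List A → B) (l : List A) :
    mulEntrySum a (splitSum F) l =
      splitSum (fun p q => mulEntrySum a (fun p' => F p' q) p + mulEntrySum a (F p) q) l := by
  induction l generalizing F with
  | nil => simp [splitSum, mulEntrySum_nil]
  | cons b l ih =>
    simp only [mulEntrySum_cons, splitSum, ih, mulEntrySum_add, splitSum_add]
    ring

end Sums

section Frobenius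

variable [CommRing A] [CommRing B] [Algebra ℝ A] [Algebra ℝ B]

/-- The Frobenius form of `f` evaluated at the entries of a list. -/
def listPhi (f : A →ₗ[ℝ] B) (l : List A) : B :=
  Phi f l.length l.get

theorem listPhi_ofFn (f : A →ₗ[ℝ] B) {n : ℕ} (a : Fin n → A) :
    listPhi f (List.ofFn a) = Phi f n a := by
  have key (l : List A) (h : l.length = n) (hl : ∀ i, l.get (Fin.cast h.symm i) = a i) :
      listPhi f l = Phi f n a := by
    subst h
    exact congrArg _ (funext hl)
  exact key _ (by simp) (by simp)

theorem listPhi_nil (f : A →ₗ[ℝ] B) : listPhi f [] = 1 := rfl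

theorem listPhi_cons (f : A →ₗ[ℝ] B) (a : A) (l : List A) :
    listPhi f (a :: l) = f a * listPhi f l - mulEntrySum a (listPhi f) l := by
  change f a * listPhi f l - _ = _
  congr 1
  refine Finset.sum_congr rfl fun i _ => ?_
  rw [← listPhi_ofFn]
  congr 1
  refine List.ext_getElem (by simp) fun j _ _ => ?_
  simp [Function.update_apply, List.getElem_set, Fin.ext_iff, eq_comm]

theorem listPhi_add (f g : A →ₗ[ℝ] B) (l : List A) :
    listPhi (f + g) l = splitSum (fun p q => listPhi f p * listPhi g q) l := by
  induction h : l.length generalizing l with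
  | zero =>
    obtain rfl := List.length_eq_zero_iff.mp h
    simp [splitSum, listPhi_nil]
  | succ k ih =>
    obtain ⟨a, l, rfl⟩ := List.exists_cons_of_length_eq_add_one h
    have hl : l.length = k := by simpa using h
    rw [listPhi_cons, mulEntrySum_congr a fun l' hl' => ih l' (hl'.trans hl), ih l hl,
      mulEntrySum_splitSum, splitSum, sub_eq_iff_eq_add, ← splitSum_const_mul, ← splitSum_add]
    congr 1
    funext p q
    simp only [listPhi_cons, mulEntrySum_const_mul, mulEntrySum_mul_const, LinearMap.add_apply]
    ring

theorem IsNHom.Phi_eq_zero {n : ℕ} {f : A →ₗ[ℝ] B} (hf : IsNHom n f) {k : ℕ} (hk : n + 1 ≤ k)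
    (a : Fin k → A) : Phi f k a = 0 := by
  induction k, hk using Nat.le_induction with
  | base => exact hf.2 a
  | succ k _ ih => simp [Phi, ih]

end Frobenius

/-- The sum of an `n`-homomorphism and an `m`-homomorphism is an `(n+m)`-homomorphism. -/
theorem IsNHom.add [CommRing A] [CommRing B] [Algebra ℝ A] [Algebra ℝ B]
    (n m : ℕ) (f g : A →ₗ[ℝ] B) (hf : IsNHom n f) (hg : IsNHom m g) :
    IsNHom (n + m) (f + g) := by
  refine ⟨by simp [hf.1, hg.1], fun a => ?_⟩
  rw [← listPhi_ofFn, listPhi_add]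
  refine splitSum_eq_zero fun p q hpq => ?_
  rw [List.length_ofFn] at hpq
  rcases Nat.lt_or_ge n p.length with hp | hp
  · rw [listPhi, hf.Phi_eq_zero hp, zero_mul]
  · rw [listPhi.eq_def g, hg.Phi_eq_zero (by omega), mul_zero]

end
end

section
/- If f : A → B is an n-homomorphism and g : B → C is an m-homomorphism between commutative unital ℝ-algebras (n, m ∈ ℕ), then the composition g ∘ f : A → C is an nm-homomorphism. -/
noncomputable section

variable {A B C : Type*}

namespace Frobenius

/-- Sum of the values of `F` over all lists obtained from `l` by multiplying one entry by `x`. -/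
def mulSum [Mul A] [AddCommMonoid C] (x : A) : (List A → C) → List A → C
  | _, [] => 0
  | F, b :: l => F ((x * b) :: l) + mulSum x (fun l' => F (b :: l')) l

/-- Sum of the values of `F` over all lists of blocks obtained by multiplying one entry of one
block by `x`. -/
def blockMulSum [Mul A] [AddCommMonoid C] (x : A) :
    (List (List A) → C) → List (List A) → C
  | _, [] => 0
  | F, S :: p => mulSum x (fun S' => F (S' :: p)) S + blockMulSum x (fun p' => F (S :: p')) p

/-- Sum of the values of `F` over all lists of blocks obtained by adding `x` to one block. -/
def insertSum [AddCommMonoid C] (x : A) : (List (List A) → C) → List (List A) → C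
  | _, [] => 0
  | F, S :: p => F ((x :: S) :: p) + insertSum x (fun p' => F (S :: p')) p

/-- Sum of the values of `F` over all partitions of the list `l` into nonempty blocks. -/
def partitionSum [AddCommMonoid C] : (List (List A) → C) → List A → C
  | F, [] => F []
  | F, x :: l => partitionSum (fun p => F ([x] :: p) + insertSum x F p) l

/-- Additivity of `G`, restricted to lists of length `k`, in each entry. -/
def MultiAdditive [Add B] [Add C] : ℕ → (List B → C) → Prop
  | 0, _ => True
  | k + 1, G =>
      (∀ l : List B, l.length = k → ∀ x y, G ((x + y) :: l) = G (x :: l) + G (y :: l)) ∧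
        ∀ b, MultiAdditive k (fun l => G (b :: l))

section Sums

theorem mulSum_congr [Mul A] [AddCommMonoid C] (x : A) {F G : List A → C} {l : List A}
    (h : ∀ l' : List A, l'.length = l.length → F l' = G l') : mulSum x F l = mulSum x G l := by
  induction l generalizing F G with
  | nil => rfl
  | cons b l ih =>
    simp only [mulSum]
    rw [h _ (by simp), ih fun l' hl' => h _ (by simp [hl'])]

theorem mulSum_zero [Mul A] [AddCommMonoid C] (x : A) (l : List A) :
    mulSum x (fun _ => (0 : C)) l = 0 := by
  induction l with
  | nil => rfl
  | cons b l ih => simp [mulSum, ih]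

theorem mulSum_add [Mul A] [AddCommMonoid C] (x : A) (F G : List A → C) (l : List A) :
    mulSum x (fun l' => F l' + G l') l = mulSum x F l + mulSum x G l := by
  induction l generalizing F G with
  | nil => simp [mulSum]
  | cons b l ih => simp only [mulSum, ih]; abel

theorem mulSum_eq_sum [Mul A] [AddCommMonoid C] (x : A) (F : List A → C) (l : List A) :
    mulSum x F l = ∑ i : Fin l.length, F (l.set i (x * l.get i)) := by
  induction l generalizing F with
  | nil => simp [mulSum]
  | cons b l ih =>
    rw [mulSum, ih]
    exact (Fin.sum_univ_succ (n := l.length)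
      (fun i => F ((b :: l).set i (x * (b :: l).get i)))).symm

theorem map_mulSum [Mul A] [AddCommMonoid B] [AddCommMonoid C] (x : A) (h : B →+ C)
    (F : List A → B) (l : List A) :
    mulSum x (fun l' => h (F l')) l = h (mulSum x F l) := by
  induction l generalizing F with
  | nil => simp [mulSum]
  | cons b l ih => simp [mulSum, ih]

theorem insertSum_add [AddCommMonoid C] (x : A) (F G : List (List A) → C) (p : List (List A)) :
    insertSum x (fun p' => F p' + G p') p = insertSum x F p + insertSum x G p := by
  induction p generalizing F G with
  | nil => simp [insertSum]
  | cons S p ih => simp only [insertSum, ih]; abel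

theorem blockMulSum_add [Mul A] [AddCommMonoid C] (x : A) (F G : List (List A) → C)
    (p : List (List A)) :
    blockMulSum x (fun p' => F p' + G p') p = blockMulSum x F p + blockMulSum x G p := by
  induction p generalizing F G with
  | nil => simp [blockMulSum]
  | cons S p ih => simp only [blockMulSum, ih, mulSum_add]; abel

theorem partitionSum_add [AddCommMonoid C] (F G : List (List A) → C) (l : List A) :
    partitionSum (fun p => F p + G p) l = partitionSum F l + partitionSum G l := by
  induction l generalizing F G with
  | nil => rfl
  | cons x l ih =>
    simp only [partitionSum, insertSum_add, ← ih]
    congr 1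
    funext p
    abel

theorem insertSum_mul_left [NonUnitalNonAssocSemiring C] (c : C) (x : A) (F : List (List A) → C)
    (p : List (List A)) : insertSum x (fun p' => c * F p') p = c * insertSum x F p := by
  induction p generalizing F with
  | nil => simp [insertSum]
  | cons S p ih => simp only [insertSum, ih, mul_add]

theorem partitionSum_mul_left [NonUnitalNonAssocSemiring C] (c : C) (F : List (List A) → C)
    (l : List A) : partitionSum (fun p => c * F p) l = c * partitionSum F l := by
  induction l generalizing F with
  | nil => rfl
  | cons x l ih => simp only [partitionSum, insertSum_mul_left, ← ih, mul_add]

theorem insertSum_eq_zero [AddCommMonoid C] (x : A) {F : List (List A) → C} {p : List (List A)}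
    (h : ∀ q : List (List A), (q.map List.length).sum = (p.map List.length).sum + 1 → F q = 0) :
    insertSum x F p = 0 := by
  induction p generalizing F with
  | nil => rfl
  | cons S p ih =>
    rw [insertSum, h _ (by simp; omega), ih, add_zero]
    intro q hq
    exact h _ (by simp [hq]; omega)

theorem partitionSum_eq_zero [AddCommMonoid C] {F : List (List A) → C} {l : List A}
    (h : ∀ p : List (List A), (p.map List.length).sum = l.length → F p = 0) :
    partitionSum F l = 0 := by
  induction l generalizing F with
  | nil => exact h _ rfl
  | cons x l ih =>
    refine ih fun p hp => ?_
    rw [h _ (by simp [hp]; omega), insertSum_eq_zero, add_zero]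
    intro q hq
    exact h _ (by simp [hq, hp])

theorem insertSum_mulSum_comm [Mul A] [AddCommMonoid C] (x b : A)
    (F : List A → List (List A) → C) (S : List A) (p : List (List A)) :
    insertSum b (fun p' => mulSum x (fun S' => F S' p') S) p =
      mulSum x (fun S' => insertSum b (F S') p) S := by
  induction p generalizing F with
  | nil => simp [insertSum, mulSum_zero]
  | cons U p ih => simp only [insertSum, mulSum_add, ih fun S' p' => F S' (U :: p')]

theorem insertSum_blockMulSum [Mul A] [AddCommMonoid C] (x b : A) (F : List (List A) → C)
    (p : List (List A)) :
    insertSum b (blockMulSum x F) p =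
      insertSum (x * b) F p + blockMulSum x (insertSum b F) p := by
  induction p generalizing F with
  | nil => simp [insertSum, blockMulSum]
  | cons S p ih =>
    simp only [insertSum, blockMulSum, mulSum, mulSum_add, insertSum_add, blockMulSum_add, ih]
    rw [insertSum_mulSum_comm x b (fun S' p' => F (S' :: p'))]
    abel

theorem mulSum_partitionSum [Mul A] [AddCommMonoid C] (x : A) (F : List (List A) → C)
    (l : List A) : mulSum x (partitionSum F) l = partitionSum (blockMulSum x F) l := by
  induction l generalizing F with
  | nil => rfl
  | cons b l ih =>
    simp only [mulSum, partitionSum, ih, ← partitionSum_add]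
    congr 1
    funext p
    simp only [blockMulSum, mulSum, insertSum_blockMulSum, blockMulSum_add]
    abel

end Sums

namespace MultiAdditive

theorem congr [Add B] [Add C] {k : ℕ} {F G : List B → C}
    (h : ∀ l : List B, l.length = k → F l = G l) (hF : MultiAdditive k F) :
    MultiAdditive k G := by
  induction k generalizing F G with
  | zero => trivial
  | succ k ih =>
    refine ⟨fun l hl x y => ?_, fun b => ih (fun l hl => h _ (by simp [hl])) (hF.2 b)⟩
    rw [← h _ (by simp [hl]), ← h _ (by simp [hl]), ← h _ (by simp [hl]), hF.1 l hl]

theorem add [Add B] [AddCommMonoid C] {k : ℕ} {F G : List B → C}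
    (hF : MultiAdditive k F) (hG : MultiAdditive k G) :
    MultiAdditive k (fun l => F l + G l) := by
  induction k generalizing F G with
  | zero => trivial
  | succ k ih =>
    refine ⟨fun l hl x y => ?_, fun b => ih (hF.2 b) (hG.2 b)⟩
    simp only [hF.1 l hl, hG.1 l hl]
    abel

theorem mul_left [Add B] [NonUnitalNonAssocSemiring C] {k : ℕ} {F : List B → C}
    (c : C) (hF : MultiAdditive k F) : MultiAdditive k (fun l => c * F l) := by
  induction k generalizing F with
  | zero => trivial
  | succ k ih =>
    refine ⟨fun l hl x y => ?_, fun b => ih (hF.2 b)⟩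
    simp only [hF.1 l hl, mul_add]

theorem mulSum [NonUnitalNonAssocSemiring B] [AddCommMonoid C] {k : ℕ} {G : List B → C}
    (c : B) (hG : MultiAdditive k G) : MultiAdditive k (mulSum c G) := by
  induction k generalizing G with
  | zero => trivial
  | succ k ih =>
    refine ⟨fun l hl x y => ?_, fun b => (hG.2 (c * b)).add (ih (hG.2 b))⟩
    simp only [Frobenius.mulSum, mul_add]
    rw [hG.1 l hl, mulSum_congr c (G := fun l' => G (x :: l') + G (y :: l'))
      (fun l' hl' => hG.1 l' (hl'.trans hl) x y), mulSum_add]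
    abel

theorem mulSum_add_left [NonUnitalNonAssocSemiring B] [AddCommMonoid C] {k : ℕ}
    {G : List B → C} (hG : MultiAdditive k G) (x y : B) {l : List B} (hl : l.length = k) :
    Frobenius.mulSum (x + y) G l = Frobenius.mulSum x G l + Frobenius.mulSum y G l := by
  induction k generalizing G l with
  | zero => simp_all [Frobenius.mulSum]
  | succ k ih =>
    obtain _ | ⟨b, l⟩ := l
    · simp at hl
    · have hl' : l.length = k := by simpa using hl
      simp only [Frobenius.mulSum, add_mul, hG.1 l hl', ih (hG.2 b) hl']
      abel

theorem eq_zero_of_mem [AddGroup B] [AddCommGroup C] {k : ℕ} {G : List B → C}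
    (hG : MultiAdditive k G) {l : List B} (hl : l.length = k) (h0 : (0 : B) ∈ l) : G l = 0 := by
  induction k generalizing G l with
  | zero => simp_all
  | succ k ih =>
    obtain _ | ⟨b, l⟩ := l
    · simp at hl
    · have hl' : l.length = k := by simpa using hl
      rcases List.mem_cons.1 h0 with rfl | h
      · simpa using hG.1 l hl' 0 0
      · exact ih (hG.2 b) hl' h

end MultiAdditive

section Phi

variable [CommRing A] [CommRing B] [CommRing C] [Algebra ℝ A] [Algebra ℝ B]

/-- The Frobenius form of `f` evaluated at the entries of a list. -/
def listPhi (f : A →ₗ[ℝ] B) (l : List A) : B := Phi f l.length l.get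

theorem listPhi_ofFn (f : A →ₗ[ℝ] B) {k : ℕ} (a : Fin k → A) :
    listPhi f (List.ofFn a) = Phi f k a := by
  have : ∀ (j : ℕ) (h : j = k) (b : Fin j → A), (∀ i, b i = a (Fin.cast h i)) →
      Phi f j b = Phi f k a := by
    rintro j rfl b hb
    exact congrArg _ (funext hb)
  exact this _ (List.length_ofFn) _ (fun i => by simp; rfl)

theorem listPhi_cons (f : A →ₗ[ℝ] B) (x : A) (l : List A) :
    listPhi f (x :: l) = f x * listPhi f l - mulSum x (listPhi f) l := by
  rw [mulSum_eq_sum]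
  change f x * Phi f l.length l.get - _ = _
  congr 1
  refine Finset.sum_congr rfl fun i _ => ?_
  rw [← listPhi_ofFn]
  congr 1
  refine List.ext_getElem (by simp) fun j h₁ h₂ => ?_
  simp only [List.getElem_ofFn, Function.update_apply, List.getElem_set, Fin.ext_iff]
  by_cases h : (i : ℕ) = j
  · simp [h]
  · simp [h, Ne.symm h]

theorem listPhi_singleton (f : A →ₗ[ℝ] B) (x : A) : listPhi f [x] = f x := by
  rw [listPhi_cons]
  simp [mulSum, listPhi, Phi]

theorem multiAdditive_listPhi (f : A →ₗ[ℝ] B) (k : ℕ) : MultiAdditive k (listPhi f) := by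
  induction k with
  | zero => trivial
  | succ k ih =>
    refine ⟨fun l hl x y => ?_, fun b => ?_⟩
    · simp only [listPhi_cons, map_add, ih.mulSum_add_left x y hl]
      ring
    · refine ((ih.mul_left (f b)).add ((ih.mulSum b).mul_left (-1))).congr fun l _ => ?_
      rw [listPhi_cons]
      ring

theorem listPhi_eq_zero {n : ℕ} {f : A →ₗ[ℝ] B} (hf : IsNHom n f) {l : List A}
    (hl : n < l.length) : listPhi f l = 0 := by
  obtain ⟨d, hd⟩ := Nat.exists_eq_add_of_lt hl
  induction d generalizing l with
  | zero =>
    have : ∀ (j : ℕ) (_ : j = n + 1) (b : Fin j → A), Phi f j b = 0 := by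
      rintro j rfl b
      exact hf.2 b
    exact this _ hd _
  | succ d ih =>
    obtain _ | ⟨x, l⟩ := l
    · simp at hd
    · have hl' : l.length = n + d + 1 := by simp at hd; omega
      rw [listPhi_cons, ih (by omega) hl', mulSum_congr x (G := fun _ => 0), mulSum_zero]
      · simp
      · intro l' h
        exact ih (by omega) (h.trans hl')

theorem insertSum_add_blockMulSum (f : A →ₗ[ℝ] B) (x : A) {G : List B → C}
    {p : List (List A)} (hG : MultiAdditive p.length G) :
    insertSum x (fun q => G (q.map (listPhi f))) p +
        blockMulSum x (fun q => G (q.map (listPhi f))) p =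
      mulSum (f x) G (p.map (listPhi f)) := by
  induction p generalizing G with
  | nil => simp [insertSum, blockMulSum, mulSum]
  | cons S p ih =>
    have hS := ih (hG.2 (listPhi f S))
    let h : B →+ C := AddMonoidHom.mk' (fun z => G (z :: p.map (listPhi f)))
      fun y z => hG.1 _ (by simp) y z
    have hm : mulSum x (fun S' => G (listPhi f S' :: p.map (listPhi f))) S =
        h (mulSum x (listPhi f) S) := map_mulSum x h (listPhi f) S
    have hx : G (listPhi f (x :: S) :: p.map (listPhi f)) = h (listPhi f (x :: S)) := rfl
    have hfx : G (f x * listPhi f S :: p.map (listPhi f)) = h (f x * listPhi f S) := rfl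
    simp only [insertSum, blockMulSum, List.map_cons, mulSum] at hS ⊢
    rw [← hS, hm, hx, hfx, listPhi_cons, map_sub]
    abel

/-- The Frobenius form of a composition is a sum over partitions of the arguments. -/
theorem listPhi_comp [Algebra ℝ C] (f : A →ₗ[ℝ] B) (g : B →ₗ[ℝ] C) (l : List A) :
    listPhi (g.comp f) l = partitionSum (fun p => listPhi g (p.map (listPhi f))) l := by
  induction hk : l.length generalizing l with
  | zero =>
    rw [List.length_eq_zero_iff.1 hk]
    rfl
  | succ k ih =>
    obtain _ | ⟨x, l⟩ := l
    · simp at hk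
    · have hl : l.length = k := by simpa using hk
      rw [listPhi_cons, ih l hl, mulSum_congr x (fun l' hl' => ih l' (hl'.trans hl)),
        mulSum_partitionSum, partitionSum, sub_eq_iff_eq_add, ← partitionSum_add,
        LinearMap.comp_apply, ← partitionSum_mul_left]
      congr 1
      funext p
      rw [add_assoc, insertSum_add_blockMulSum f x (multiAdditive_listPhi g _), List.map_cons,
        listPhi_singleton, listPhi_cons]
      ring

end Phi

end Frobenius

/-- The composition of an `n`-homomorphism `f : A → B` with an `m`-homomorphism
`g : B → C` is an `nm`-homomorphism. -/
theorem IsNHom.comp [CommRing A] [CommRing B] [CommRing C]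
    [Algebra ℝ A] [Algebra ℝ B] [Algebra ℝ C]
    (n m : ℕ) (f : A →ₗ[ℝ] B) (g : B →ₗ[ℝ] C)
    (hf : IsNHom n f) (hg : IsNHom m g) :
    IsNHom (n * m) (g.comp f) := by
  refine ⟨?_, fun a => ?_⟩
  · rw [LinearMap.comp_apply, hf.1, ← nsmul_one, map_nsmul, hg.1, nsmul_eq_mul, Nat.cast_mul]
  · rw [← Frobenius.listPhi_ofFn, Frobenius.listPhi_comp]
    refine Frobenius.partitionSum_eq_zero fun p hp => ?_
    by_cases h : ∃ S ∈ p, n < S.length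
    · obtain ⟨S, hS, hn⟩ := h
      refine (Frobenius.multiAdditive_listPhi g _).eq_zero_of_mem rfl ?_
      exact List.mem_map.2 ⟨S, hS, Frobenius.listPhi_eq_zero hf hn⟩
    · push Not at h
      refine Frobenius.listPhi_eq_zero hg ?_
      have hle : (p.map List.length).sum ≤ (p.map List.length).length • n :=
        List.sum_le_card_nsmul _ _ (by simpa using h)
      rw [hp, List.length_ofFn, List.length_map, smul_eq_mul, mul_comm n m] at hle
      rw [List.length_map]
      exact lt_of_mul_lt_mul_right (Nat.lt_of_succ_le hle) (Nat.zero_le n)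

end
end

section
/- If χ₁, …, χₙ : A → B are unital ℝ-algebra homomorphisms (n ∈ ℕ), then their sum f = χ₁ + ⋯ + χₙ is an n-homomorphism. In particular, for a compact Hausdorff space X and points x₁, …, xₙ ∈ X, the linear functional a ↦ a(x₁) + ⋯ + a(xₙ) on C(X,ℝ) is an n-homomorphism C(X,ℝ) → ℝ. -/
noncomputable section

variable {A B : Type*}

open Classical in
theorem sum_ite_injective_cons {ι M : Type*} [Fintype ι] [AddCommGroup M] {k : ℕ}
    (s : Fin k → ι) (g : ι → M) :
    (∑ j, if Function.Injective (Fin.cons j s : Fin (k + 1) → ι) then g j else 0) =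
      if Function.Injective s then ∑ j, g j - ∑ i, g (s i) else 0 := by
  simp only [Fin.cons_injective_iff]
  split_ifs with hs
  · have hsum : ∑ i, g (s i) = ∑ j, if j ∈ Set.range s then g j else 0 := by
      rw [← Finset.sum_image (f := g) (s := Finset.univ) (g := s) (fun x _ y _ h => hs h),
        ← Finset.sum_filter]
      congr 1
      ext j
      simp
    rw [hsum, ← Finset.sum_sub_distrib]
    refine Finset.sum_congr rfl fun j _ => ?_
    by_cases hj : j ∈ Set.range s <;> simp [hj, hs]
  · simp [hs]

/-- The Frobenius forms of a sum of algebra homomorphisms are sums over injective families of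
indices. -/
theorem Phi_sum_algHom {ι : Type*} [Fintype ι] [CommRing A] [CommRing B] [Algebra ℝ A]
    [Algebra ℝ B] (χ : ι → (A →ₐ[ℝ] B)) (k : ℕ) (a : Fin k → A) :
    Phi (∑ i, (χ i).toLinearMap) k a =
      open Classical in
      ∑ s : Fin k → ι, if Function.Injective s then ∏ i, χ (s i) (a i) else 0 := by
  classical
  induction k with
  | zero => simp [Phi, Function.injective_of_subsingleton]
  | succ k ih =>
    have hupd (s : Fin k → ι) (i : Fin k) :
        ∏ j, χ (s j) (Function.update (fun j => a j.succ) i (a 0 * a i.succ) j) =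
          χ (s i) (a 0) * ∏ j, χ (s j) (a j.succ) := by
      rw [← Finset.mul_prod_erase _ _ (Finset.mem_univ i),
        ← Finset.mul_prod_erase _ (fun j => χ (s j) (a j.succ)) (Finset.mem_univ i),
        Function.update_self, map_mul, mul_assoc]
      congr 2
      refine Finset.prod_congr rfl fun j hj => ?_
      rw [Function.update_of_ne (Finset.ne_of_mem_erase hj)]
    rw [Phi]
    simp only [ih, hupd]
    rw [← (Fin.consEquiv fun _ => ι).sum_comp, Fintype.sum_prod_type, Finset.sum_comm,
      Finset.sum_comm (f := fun i (s : Fin k → ι) => ite _ _ _), Finset.mul_sum,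
      ← Finset.sum_sub_distrib]
    refine Finset.sum_congr rfl fun s _ => ?_
    have hcons := sum_ite_injective_cons s
      fun j => χ j (a 0) * ∏ i, χ (s i) (a i.succ)
    simp only [Fin.consEquiv_apply, Fin.prod_univ_succ, Fin.cons_zero, Fin.cons_succ]
    refine Eq.trans ?_ hcons.symm
    split_ifs <;> simp [Finset.sum_mul]

theorem isNHom_sum_algHom [CommRing A] [CommRing B] [Algebra ℝ A] [Algebra ℝ B]
    (n : ℕ) (χ : Fin n → (A →ₐ[ℝ] B)) : IsNHom n (∑ i, (χ i).toLinearMap) := by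
  refine ⟨by simp, fun a => ?_⟩
  rw [Phi_sum_algHom]
  refine Finset.sum_eq_zero fun s _ => if_neg fun hs => ?_
  simpa using Fintype.card_le_of_injective s hs

/-- The sum of `n` unital `ℝ`-algebra homomorphisms is an `n`-homomorphism; in
particular, for a compact Hausdorff space `X` and points `x₁, …, xₙ ∈ X`, the linear
functional `a ↦ a x₁ + ⋯ + a xₙ` on `C(X, ℝ)` is an `n`-homomorphism. -/
theorem sum_algHom_isNHom :
    (∀ (A B : Type) [CommRing A] [CommRing B] [Algebra ℝ A] [Algebra ℝ B]
        (n : ℕ) (χ : Fin n → (A →ₐ[ℝ] B)),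
      IsNHom n (∑ i : Fin n, (χ i).toLinearMap)) ∧
    (∀ (X : Type) [TopologicalSpace X] [CompactSpace X] [T2Space X]
        (n : ℕ) (x : Fin n → X) (f : C(X, ℝ) →ₗ[ℝ] ℝ),
      (∀ a : C(X, ℝ), f a = ∑ i : Fin n, a (x i)) → IsNHom n f) := by
  refine ⟨fun A B _ _ _ _ n χ => isNHom_sum_algHom n χ, fun X _ _ _ n x f hf => ?_⟩
  have hf' : f = ∑ i, (ContinuousMap.evalAlgHom ℝ ℝ (x i)).toLinearMap := by
    ext a
    simp [hf]
  rw [hf']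
  exact isNHom_sum_algHom n _

end
end

section
/- Let R be a commutative ring, let (c_k)_{k≥0} be a sequence in R, and suppose there exist polynomials P, Q ∈ R[z] with deg P ≤ p, deg Q ≤ q, and Q(0) = 1 such that Q(z)·Σ_{k≥0} c_k z^k = P(z) in R[[z]]. Then for every k ≥ p − q + 1 (with k ≥ 0), the (q+1)×(q+1) Hankel determinant det[(c_{k+i+j})_{0 ≤ i,j ≤ q}] vanishes. -/
/-- If a power series `Σ c_k z^k` over a commutative ring is a ratio `P/Q` of polynomials
with `deg P ≤ p`, `deg Q ≤ q` and `Q(0) = 1`, then all the `(q+1) × (q+1)` Hankel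
determinants `det (c_{k+i+j})` with `k ≥ p − q + 1` vanish. -/
theorem hankel_det_vanish (R : Type*) [CommRing R] (c : ℕ → R) (p q : ℕ)
    (P Q : Polynomial R) (hP : P.natDegree ≤ p) (hQ : Q.natDegree ≤ q)
    (hQ0 : Q.coeff 0 = 1)
    (h : (Q : PowerSeries R) * PowerSeries.mk c = (P : PowerSeries R)) :
    ∀ k : ℕ, (p : ℤ) - (q : ℤ) + 1 ≤ (k : ℤ) →
      (Matrix.of fun i j : Fin (q + 1) => c (k + (i : ℕ) + (j : ℕ))).det = 0 := by
  intro k hk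
  refine Matrix.det_eq_zero_of_mulVec_eq_zero_of_mem_nonZeroDivisors
    (v := fun j : Fin (q + 1) => Q.coeff (q - j)) (i := Fin.last q) ?_ ?_
  · ext i
    have hcoeff : ∑ a ∈ Finset.range (k + i + q + 1), Q.coeff a * c (k + i + q - a) = 0 := by
      have h' := congrArg (PowerSeries.coeff (k + i + q)) h
      rw [PowerSeries.coeff_mul, Finset.Nat.sum_antidiagonal_eq_sum_range_succ_mk,
        Polynomial.coeff_coe, Polynomial.coeff_eq_zero_of_natDegree_lt (by omega)] at h'
      simpa only [Polynomial.coeff_coe, PowerSeries.coeff_mk] using h'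
    rw [← Finset.sum_subset (Finset.range_mono (show q + 1 ≤ k + i + q + 1 by omega))
      fun a _ ha => by
        rw [Polynomial.coeff_eq_zero_of_natDegree_lt (by grind), zero_mul],
      ← Finset.sum_range_reflect] at hcoeff
    simp only [Matrix.mulVec, dotProduct, Matrix.of_apply, Pi.zero_apply]
    rw [Fin.sum_univ_eq_sum_range fun j => c (k + i + j) * Q.coeff (q - j), ← hcoeff]
    refine Finset.sum_congr rfl fun j hj => ?_
    have hjq : j ≤ q := Finset.mem_range_succ_iff.mp hj
    rw [mul_comm, show q + 1 - 1 - j = q - j by omega,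
      show k + i + q - (q - j) = k + i + j by omega]
  · simp [hQ0]
end

section
/- Let c ∈ ℝ and let (1+z)^c := Σ_{k≥0} binom(c,k) z^k ∈ ℝ[[z]] denote the binomial series, where binom(c,k) = c(c−1)⋯(c−k+1)/k!. Suppose there exist coprime polynomials P, Q ∈ ℝ[z] with Q(0) = 1, deg P = p, deg Q = q, such that Q(z)·(1+z)^c = P(z) in ℝ[[z]]. Then c is an integer and c = p − q. -/
open PowerSeries in
theorem one_add_X_mul_derivative_binomial (c : ℝ) :
    (1 + X) * d⁄dX ℝ (mk fun k => (∏ i ∈ Finset.range k, (c - (i : ℝ))) / (k.factorial : ℝ)) =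
      C c * mk fun k => (∏ i ∈ Finset.range k, (c - (i : ℝ))) / (k.factorial : ℝ) := by
  ext n
  rw [add_mul, one_mul, map_add, coeff_C_mul, coeff_derivative]
  cases n with
  | zero => simp
  | succ n =>
    rw [coeff_succ_X_mul, coeff_derivative]
    simp only [coeff_mk, Finset.prod_range_succ, Nat.factorial_succ]
    push_cast
    have : (n.factorial : ℝ) ≠ 0 := by positivity
    have : (n : ℝ) + 1 ≠ 0 := by positivity
    have : (n : ℝ) + 1 + 1 ≠ 0 := by positivity
    field_simp
    ring

namespace Polynomial

variable {R : Type*} [CommSemiring R]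

theorem natDegree_one_add_X_mul_derivative_le (P : R[X]) :
    ((1 + X) * derivative P).natDegree ≤ P.natDegree := by
  rw [natDegree_le_iff_coeff_eq_zero]
  rintro (_ | n) hn
  · omega
  · rw [add_mul, one_mul, coeff_add, coeff_X_mul, coeff_derivative, coeff_derivative,
      coeff_eq_zero_of_natDegree_lt hn, coeff_eq_zero_of_natDegree_lt (by omega)]
    simp

theorem coeff_natDegree_one_add_X_mul_derivative (P : R[X]) :
    ((1 + X) * derivative P).coeff P.natDegree = P.natDegree * P.leadingCoeff := by
  rw [leadingCoeff]
  rcases hn : P.natDegree with _ | n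
  · simp [coeff_derivative, coeff_eq_zero_of_natDegree_lt (p := P) (n := 1) (by omega)]
  · rw [add_mul, one_mul, coeff_add, coeff_X_mul, coeff_derivative, coeff_derivative,
      coeff_eq_zero_of_natDegree_lt (by omega)]
    push_cast
    ring

end Polynomial


/-- If the binomial series `(1+z)^c = Σ_k binom(c,k) z^k` (with
`binom(c,k) = c(c−1)⋯(c−k+1)/k!`) is a ratio `P/Q` of coprime real polynomials with
`Q(0) = 1`, `deg P = p` and `deg Q = q`, then `c` is an integer, namely `c = p − q`. -/
theorem binomialSeries_rational (c : ℝ) (P Q : Polynomial ℝ) (p q : ℕ)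
    (hcop : IsCoprime P Q) (hQ0 : Q.coeff 0 = 1)
    (hP : P.natDegree = p) (hQ : Q.natDegree = q)
    (h : (Q : PowerSeries ℝ) *
        PowerSeries.mk (fun k => (∏ i ∈ Finset.range k, (c - (i : ℝ))) / (k.factorial : ℝ)) =
      (P : PowerSeries ℝ)) :
    c = (p : ℝ) - (q : ℝ) := by
  have hPQ : (1 + Polynomial.X) * Polynomial.derivative P * Q =
      (1 + Polynomial.X) * Polynomial.derivative Q * P + Polynomial.C c * (P * Q) := by
    apply Polynomial.coe_injective ℝ
    have hF := one_add_X_mul_derivative_binomial c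
    generalize PowerSeries.mk (fun k => (∏ i ∈ Finset.range k, (c - (i : ℝ))) /
      (k.factorial : ℝ)) = F at h hF
    have hd := congrArg (PowerSeries.derivative ℝ) h
    rw [Derivation.leibniz, PowerSeries.derivative_coe, PowerSeries.derivative_coe,
      smul_eq_mul, smul_eq_mul] at hd
    push_cast
    rw [← hd, ← h]
    linear_combination (Q : PowerSeries ℝ) ^ 2 * hF
  have hP0 : P ≠ 0 := by
    rintro rfl
    have := congrArg PowerSeries.constantCoeff h
    simp [hQ0] at this
  have hQ0' : Q ≠ 0 := by
    rintro rfl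
    simp at hQ0
  have hlead := congrArg (fun A => A.coeff (P.natDegree + Q.natDegree)) hPQ
  simp only [Polynomial.coeff_add, Polynomial.coeff_C_mul,
    Polynomial.coeff_mul_degree_add_degree] at hlead
  rw [Polynomial.coeff_mul_add_eq_of_natDegree_le P.natDegree_one_add_X_mul_derivative_le le_rfl,
    add_comm P.natDegree,
    Polynomial.coeff_mul_add_eq_of_natDegree_le Q.natDegree_one_add_X_mul_derivative_le le_rfl,
    Polynomial.coeff_natDegree_one_add_X_mul_derivative,
    Polynomial.coeff_natDegree_one_add_X_mul_derivative,
    Polynomial.coeff_natDegree, Polynomial.coeff_natDegree, hP, hQ] at hlead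
  apply mul_right_cancel₀
    (mul_ne_zero (Polynomial.leadingCoeff_ne_zero.2 hP0) (Polynomial.leadingCoeff_ne_zero.2 hQ0'))
  linear_combination -hlead
end
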